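/- Let f = a/d^j ∈ F(x) with j ≥ 1, a ∈ F(x̂₁)[x₁], d ∈ F[x] irreducible and normal with respect to θ_{x₁}, and deg_{x₁}(a) < deg_{x₁}(d). Let θ₁,…,θ_r (1 ≤ r < n) be a basis of the isotropy group G_d (taking θ₁ = 1 if G_d is trivial), with θ_i = θ_x^{α_i} for α_i ∈ ℤⁿ and θ_i(d) = ε_i·d for nonzero ε_i ∈ F. Then for any c = (c₁,…,cₙ) with all c_i ∈ F nonzero, f is (c₁θ_{x₁},…,cₙθ_{xₙ})-summable in F(x) if and only if there exist b₁,…,b_r ∈ F(x̂₁)[x₁] with deg_{x₁}(b_i) < deg_{x₁}(d) such that a = Σ_{i=1}^r (ε_i^{−j}·c^{α_i}·θ_i(b_i) − b_i). -/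

import Mathlib

noncomputable section

/-- The field of rational functions `F(x₁,…,xₙ)`, modeled as the fraction field of the
multivariate polynomial ring. -/
abbrev MvRat (F : Type*) [Field F] (n : ℕ) := FractionRing (MvPolynomial (Fin n) F)

/-- The image of the variable `xᵢ` in `F(x₁,…,xₙ)`. -/
def xv {F : Type*} [Field F] {n : ℕ} (i : Fin n) : MvRat F n :=
  algebraMap (MvPolynomial (Fin n) F) (MvRat F n) (MvPolynomial.X i)

/-- The subfield `F(x₂,…,xₙ)` of `F(x₁,…,xₙ)` (the variable `x₁` has index `0`). -/
def hatField (F : Type*) [Field F] (n : ℕ) [NeZero n] : Subfield (MvRat F n) :=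
  Subfield.closure (Set.range (algebraMap F (MvRat F n)) ∪ (xv '' {i : Fin n | i ≠ 0}))

/-- `a` is a polynomial in `x1` over the subfield `E` of degree `< D`. -/
def IsPolyDeg {L : Type*} [Field L] (E : Subfield L) (x1 : L) (D : ℕ) (a : L) : Prop :=
  ∃ cf : Fin D → E, a = ∑ k : Fin D, (cf k : L) * x1 ^ (k : ℕ)

/-- `a` is a polynomial in `x1` over the subfield `E`, i.e. `a ∈ E[x1]`. -/
def IsPolyE {L : Type*} [Field L] (E : Subfield L) (x1 a : L) : Prop :=
  ∃ D : ℕ, IsPolyDeg E x1 D a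

/-- `a` is a Laurent polynomial in `x1` over the subfield `E`, i.e. `a ∈ E[x1, x1⁻¹]`. -/
def IsLaurent {L : Type*} [Field L] (E : Subfield L) (x1 a : L) : Prop :=
  ∃ (s : Finset ℤ) (cf : ℤ → L), (∀ k ∈ s, cf k ∈ E) ∧ a = ∑ k ∈ s, cf k * x1 ^ k

/-- For a family `θ` of `F`-automorphisms and an exponent vector `α`,
the product `∏ i, θᵢ^(αᵢ)` (the element `θ_x^α` of the group generated by the `θᵢ`). -/
def thetaPowS {F L : Type*} [CommSemiring F] [Semiring L] [Algebra F L] {ι : Type*} [Fintype ι]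
    (θ : ι → (L ≃ₐ[F] L)) (α : ι → ℤ) : L ≃ₐ[F] L :=
  (Finset.univ.toList.map fun i => θ i ^ α i).prod

/-- Membership in the space `V_{[d]_G,j}`: `f` is a finite sum of fractions `a_g / g(d)^j`
with `g` in the group `G` and `a_g ∈ E[x₁]` of degree `< D` (`= deg_{x₁} d`). -/
def MemV {F L : Type*} [Field F] [Field L] [Algebra F L] (G : Set (L ≃ₐ[F] L))
    (E : Subfield L) (x1 : L) (dd : L) (D j : ℕ) (f : L) : Prop :=
  ∃ s : Finset (L ≃ₐ[F] L), ↑s ⊆ G ∧ ∃ a : (L ≃ₐ[F] L) → L,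
    (∀ g ∈ s, IsPolyDeg E x1 D (a g)) ∧ f = ∑ g ∈ s, a g / (g dd) ^ j

/-- `p` and `p'` are `G`-equivalent: `p = c · g(p')` for some nonzero `c ∈ F` and `g ∈ G`. -/
def GEquivSet {F L : Type*} [Field F] [Field L] [Algebra F L] (G : Set (L ≃ₐ[F] L))
    (p p' : L) : Prop :=
  ∃ c : F, c ≠ 0 ∧ ∃ g ∈ G, p = algebraMap F L c * g p'

/-- `w` divides `p` inside the ring `E[x1]`. -/
def DvdE {L : Type*} [Field L] (E : Subfield L) (x1 w p : L) : Prop :=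
  ∃ u : L, IsPolyE E x1 u ∧ p = w * u

/-- `p ∈ E[x₁]` is normal w.r.t. `θ1`: `gcd(p, θ1^ℓ(p)) = 1` for all nonzero `ℓ ∈ ℤ`,
i.e. every common divisor (in `E[x₁]`) of `p` and `θ1^ℓ(p)` is a unit (lies in `E`). -/
def NormalWrt {F L : Type*} [Field F] [Field L] [Algebra F L] (E : Subfield L) (x1 : L)
    (θ1 : L ≃ₐ[F] L) (p : L) : Prop :=
  ∀ ℓ : ℤ, ℓ ≠ 0 → ∀ w : L, IsPolyE E x1 w →
    DvdE E x1 w p → DvdE E x1 w ((θ1 ^ ℓ) p) → w ∈ E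

/-- The isotropy group of `p` (in exponent-vector coordinates): the subgroup of `ℤ^ι`
of all `α` with `Θ(α)(p) = c·p` for some nonzero `c ∈ F`. -/
def isotropyZ {F L : Type*} [Field F] [Field L] [Algebra F L] {ι : Type*}
    (Θ : (ι → ℤ) → (L ≃ₐ[F] L))
    (hadd : ∀ α β, Θ (α + β) = Θ α * Θ β) (h0 : Θ 0 = 1) (p : L) :
    AddSubgroup (ι → ℤ) where
  carrier := {α | ∃ c : F, c ≠ 0 ∧ Θ α p = algebraMap F L c * p}
  zero_mem' := ⟨1, one_ne_zero, by simp [h0]⟩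
  add_mem' := by
    rintro α β ⟨c, hc, hcp⟩ ⟨e, he, hep⟩
    refine ⟨e * c, mul_ne_zero he hc, ?_⟩
    rw [hadd, AlgEquiv.mul_apply, hep, map_mul, AlgEquiv.commutes, hcp, map_mul]
    ring
  neg_mem' := by
    rintro α ⟨c, hc, hcp⟩
    refine ⟨c⁻¹, inv_ne_zero hc, ?_⟩
    have h1 : Θ (-α) (Θ α p) = p := by
      rw [← AlgEquiv.mul_apply, ← hadd, neg_add_cancel, h0, AlgEquiv.one_apply]
    rw [hcp, map_mul, AlgEquiv.commutes] at h1
    have hc0 : (algebraMap F L) c ≠ 0 :=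
      (map_ne_zero_iff _ (algebraMap F L).injective).mpr hc
    rw [map_inv₀, eq_inv_mul_iff_mul_eq₀ hc0]
    exact h1

end

/-- If an additive map `π` is invariant under a subgroup `H` of a group `Γ` acting through `T`,
vanishes on all but finitely many `H`-cosets of translates of each element, and vanishes on all
translates of `f` outside `H`, then it vanishes on `f` as soon as `f` is a sum of differences
`T γ g - g`. -/
theorem map_eq_zero_of_eq_sum_sub {Γ L Q ι : Type*} [AddCommGroup Γ] [AddCommGroup L]
    [AddCommGroup Q] [Fintype ι] (T : Γ → L →+ L) (hT0 : ∀ h, T 0 h = h)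
    (hTadd : ∀ β γ h, T (β + γ) h = T β (T γ h)) (H : AddSubgroup Γ) (π : L →+ Q)
    (hπH : ∀ γ ∈ H, ∀ h, π (T γ h) = π h)
    (hfin : ∀ h, {x : Γ ⧸ H | ∃ β : Γ, (β : Γ ⧸ H) = x ∧ π (T (-β) h) ≠ 0}.Finite)
    (f : L) (hf : ∀ β ∉ H, π (T β f) = 0) (γ : ι → Γ) (g : ι → L)
    (hfg : f = ∑ i, (T (γ i) (g i) - g i)) : π f = 0 := by
  let ψ : L → Γ ⧸ H → Q := fun h x => π (T (-x.out) h)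
  have hψ : ∀ h (β : Γ), ψ h (β : Γ ⧸ H) = π (T (-β) h) := by
    intro h β
    obtain ⟨η, hη⟩ := QuotientAddGroup.mk_out_eq_add H β
    have h1 : -(Quotient.out (β : Γ ⧸ H)) = -(η : Γ) + -β := by
      rw [hη]; abel
    simp only [ψ]
    rw [h1, hTadd, hπH _ (H.neg_mem η.2)]
  have hψfin : ∀ h, (ψ h).HasFiniteSupport := by
    intro h
    refine (hfin h).subset fun x hx => ⟨x.out, Quotient.out_eq' x, hx⟩
  let Φ : L →+ Q := AddMonoidHom.mk' (fun h => ∑ᶠ x, ψ h x) (by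
    intro h h'
    rw [← finsum_add_distrib (hψfin h) (hψfin h')]
    simp [ψ])
  have hΦT : ∀ β h, Φ (T β h) = Φ h := by
    intro β h
    change ∑ᶠ x, ψ (T β h) x = ∑ᶠ x, ψ h x
    rw [← finsum_comp_equiv (f := ψ h) (Equiv.subRight (β : Γ ⧸ H))]
    refine finsum_congr fun x => ?_
    induction x using QuotientAddGroup.induction_on with
    | H δ =>
      rw [Equiv.subRight_apply, ← QuotientAddGroup.mk_sub, hψ, hψ, ← hTadd, neg_sub, sub_eq_neg_add]
  have hΦf : Φ f = π f := by
    change ∑ᶠ x, ψ f x = π f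
    rw [finsum_eq_single _ ((0 : Γ) : Γ ⧸ H), hψ, neg_zero, hT0]
    intro x hx
    induction x using QuotientAddGroup.induction_on with
    | H δ =>
      rw [hψ, hf]
      intro hδ
      exact hx ((QuotientAddGroup.eq_zero_iff δ).2 (neg_mem_iff.1 hδ))
  rw [← hΦf, hfg, map_sum]
  exact Finset.sum_eq_zero fun i _ => by rw [map_sub, hΦT, sub_self]

/-- The subgroup generated by `O` and the fractions `b / d ^ k`, `b ∈ P`, `k ≠ j`. -/
def coeffComplement {L : Type*} [Field L] (O : Subring L) (P : AddSubgroup L) (d : L) (j : ℕ) :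
    AddSubgroup L :=
  AddSubgroup.closure ((O : Set L) ∪ {h | ∃ k, k ≠ j ∧ ∃ b ∈ P, h = b / d ^ k})

section coeff

variable {L : Type*} [Field L] {O : Subring L} {P : AddSubgroup L} {d : L} {j : ℕ}

theorem mem_coeffComplement_of_mem {h : L} (hh : h ∈ O) : h ∈ coeffComplement O P d j :=
  AddSubgroup.subset_closure (Or.inl hh)

theorem div_pow_mem_coeffComplement {b : L} (hb : b ∈ P) {k : ℕ} (hk : k ≠ j) :
    b / d ^ k ∈ coeffComplement O P d j :=
  AddSubgroup.subset_closure (Or.inr ⟨k, hk, b, hb, rfl⟩)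

theorem map_mem_coeffComplement (T : L →+ L) (hTO : ∀ h ∈ O, T h ∈ O) (hd : d ≠ 0)
    (hTP : ∀ k, ∀ b ∈ P, d ^ k * T (b / d ^ k) ∈ P) {h : L}
    (hh : h ∈ coeffComplement O P d j) : T h ∈ coeffComplement O P d j := by
  refine (AddSubgroup.closure_le (K := (coeffComplement O P d j).comap T)).2 ?_ hh
  rintro x (hx | ⟨k, hk, b, hb, rfl⟩)
  · exact mem_coeffComplement_of_mem (hTO x hx)
  · have := div_pow_mem_coeffComplement (O := O) (d := d) (hTP k b hb) hk
    rwa [mul_div_cancel_left₀ _ (pow_ne_zero k hd)] at this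

theorem exists_sum_of_mem_coeffComplement {h : L} (hh : h ∈ coeffComplement O P d j) :
    ∃ p : ℕ →₀ L, (∀ k, p k ∈ P) ∧ p j = 0 ∧ h - p.sum (fun k b => b / d ^ k) ∈ O := by
  have hz : ∀ k : ℕ, (0 : L) / d ^ k = 0 := fun k => zero_div _
  have ha : ∀ (k : ℕ) (x y : L), (x + y) / d ^ k = x / d ^ k + y / d ^ k :=
    fun k x y => add_div _ _ _
  induction hh using AddSubgroup.closure_induction with
  | mem x hx =>
    rcases hx with hx | ⟨k, hk, b, hb, rfl⟩
    · exact ⟨0, fun _ => P.zero_mem, rfl, by simpa using hx⟩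
    · refine ⟨Finsupp.single k b, fun l => ?_, by simp [hk], ?_⟩
      · rw [Finsupp.single_apply]
        split_ifs
        exacts [hb, P.zero_mem]
      · rw [Finsupp.sum_single_index (hz k), sub_self]
        exact O.zero_mem
  | zero => exact ⟨0, fun _ => P.zero_mem, rfl, by simp⟩
  | add x y _ _ hx hy =>
    obtain ⟨p, hp, hpj, hpO⟩ := hx
    obtain ⟨p', hp', hpj', hpO'⟩ := hy
    refine ⟨p + p', fun k => P.add_mem (hp k) (hp' k), by simp [hpj, hpj'], ?_⟩
    rw [Finsupp.sum_add_index' hz ha, add_sub_add_comm]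
    exact O.add_mem hpO hpO'
  | neg x _ hx =>
    obtain ⟨p, hp, hpj, hpO⟩ := hx
    refine ⟨-p, fun k => P.neg_mem (hp k), by simp [hpj], ?_⟩
    rw [Finsupp.sum_neg_index hz]
    have := O.neg_mem hpO
    simp only [neg_div, Finsupp.sum, Finset.sum_neg_distrib] at this ⊢
    rwa [neg_sub_neg, ← neg_sub]

theorem coeff_eq_zero_of_sum_mem (hd : d ≠ 0) (hdO : d ∈ O) (hPO : ∀ b ∈ P, b ∈ O)
    (huniq : ∀ b ∈ P, ∀ o ∈ O, b = d * o → b = 0) (p : ℕ → L) (hp : ∀ k, p k ∈ P) (m : ℕ)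
    (hm : ∑ k ∈ Finset.range (m + 1), p k / d ^ k ∈ O) (k : ℕ) (hk : 1 ≤ k) (hkm : k ≤ m) :
    p k = 0 := by
  induction m with
  | zero => omega
  | succ m ih =>
    have hlast : p (m + 1) = 0 := by
      refine huniq _ (hp _) (d ^ m * ∑ k ∈ Finset.range (m + 1 + 1), p k / d ^ k -
        ∑ k ∈ Finset.range (m + 1), p k * d ^ (m - k)) ?_ ?_
      · exact O.sub_mem (O.mul_mem (O.pow_mem hdO _) hm)
          (O.sum_mem fun k _ => O.mul_mem (hPO _ (hp k)) (O.pow_mem hdO _))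
      · have : d ^ m * ∑ k ∈ Finset.range (m + 1), p k / d ^ k =
            ∑ k ∈ Finset.range (m + 1), p k * d ^ (m - k) := by
          rw [Finset.mul_sum]
          refine Finset.sum_congr rfl fun k hk => ?_
          rw [pow_sub₀ _ hd (Nat.lt_succ_iff.1 (Finset.mem_range.1 hk))]
          ring
        rw [Finset.sum_range_succ _ (m + 1), mul_add, this, add_sub_cancel_left]
        field_simp
        ring
    rcases hkm.lt_or_eq with hlt | rfl
    · rw [Finset.sum_range_succ, hlast, zero_div, add_zero] at hm
      exact ih hm (by omega)
    · exact hlast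

theorem eq_zero_of_div_pow_mem_coeffComplement (hd : d ≠ 0) (hdO : d ∈ O)
    (hPO : ∀ b ∈ P, b ∈ O) (huniq : ∀ b ∈ P, ∀ o ∈ O, b = d * o → b = 0) (hj : 1 ≤ j)
    {b : L} (hb : b ∈ P) (h : b / d ^ j ∈ coeffComplement O P d j) : b = 0 := by
  obtain ⟨p, hp, hpj, hpO⟩ := exists_sum_of_mem_coeffComplement h
  have hz : ∀ k : ℕ, (0 : L) / d ^ k = 0 := fun k => zero_div _
  have ha : ∀ (k : ℕ) (x y : L), (x - y) / d ^ k = x / d ^ k - y / d ^ k :=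
    fun k x y => sub_div _ _ _
  let p' : ℕ →₀ L := Finsupp.single j b - p
  have hp' : ∀ k, p' k ∈ P := by
    intro k
    refine P.sub_mem ?_ (hp k)
    rw [Finsupp.single_apply]
    split_ifs
    exacts [hb, P.zero_mem]
  have hsum : p'.sum (fun k b => b / d ^ k) ∈ O := by
    rwa [Finsupp.sum_sub_index ha, Finsupp.sum_single_index (hz j)]
  have hpj' : p' j = b := by simp [p', hpj]
  let m := max j (p'.support.sup id)
  rw [Finsupp.sum_of_support_subset p' (s := Finset.range (m + 1)) ?_ _ fun k _ => hz k] at hsum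
  · rw [← hpj']
    exact coeff_eq_zero_of_sum_mem hd hdO hPO huniq p' hp' m hsum j hj (le_max_left _ _)
  · intro k hk
    have : k ≤ p'.support.sup id := Finset.le_sup (f := id) hk
    exact Finset.mem_range.2 (Nat.lt_succ_iff.2 (this.trans (le_max_right _ _)))

theorem exists_sub_div_pow_mem_coeffComplement (hd : d ≠ 0)
    (hdiv : ∀ o ∈ O, ∃ b ∈ P, ∃ o' ∈ O, o = b + d * o')
    (hloc : ∀ h, ∃ m : ℕ, d ^ m * h ∈ O) (h : L) :
    ∃ b ∈ P, h - b / d ^ j ∈ coeffComplement O P d j := by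
  obtain ⟨m, hm⟩ := hloc h
  induction m generalizing h with
  | zero =>
    rw [pow_zero, one_mul] at hm
    exact ⟨0, P.zero_mem, by simpa using mem_coeffComplement_of_mem hm⟩
  | succ m ih =>
    obtain ⟨b, hb, o, ho, hbo⟩ := hdiv _ hm
    have hrest : d ^ m * (h - b / d ^ (m + 1)) = o := by
      have : d * (d ^ m * (h - b / d ^ (m + 1))) = d ^ (m + 1) * h - b := by
        field_simp
        ring
      rw [hbo, add_sub_cancel_left] at this
      exact mul_left_cancel₀ hd this
    obtain ⟨b', hb', hN⟩ := ih (h - b / d ^ (m + 1)) (hrest ▸ ho)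
    by_cases hjm : m + 1 = j
    · refine ⟨b + b', P.add_mem hb hb', ?_⟩
      rwa [hjm, sub_sub, ← add_div] at hN
    · refine ⟨b', hb', ?_⟩
      have := add_mem hN (div_pow_mem_coeffComplement (O := O) (d := d) hb hjm)
      rwa [sub_right_comm, sub_add_cancel] at this

/-- The coefficient of `d ^ (-j)` in the `d`-adic expansion with digits in `P`, together with its
compatibility with additive maps that preserve the expansions. -/
theorem exists_coeff (hd : d ≠ 0) (hdO : d ∈ O) (hPO : ∀ b ∈ P, b ∈ O)
    (huniq : ∀ b ∈ P, ∀ o ∈ O, b = d * o → b = 0)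
    (hdiv : ∀ o ∈ O, ∃ b ∈ P, ∃ o' ∈ O, o = b + d * o')
    (hloc : ∀ h, ∃ m : ℕ, d ^ m * h ∈ O) (hj : 1 ≤ j) :
    ∃ π : L →+ L, (∀ h, π h ∈ P) ∧ (∀ h ∈ O, π h = 0) ∧ (∀ b ∈ P, π (b / d ^ j) = b) ∧
      ∀ T : L →+ L, (∀ h ∈ O, T h ∈ O) → (∀ k, ∀ b ∈ P, d ^ k * T (b / d ^ k) ∈ P) →
        ∀ h, π (T h) = d ^ j * T (π h / d ^ j) := by
  choose π hπP hπN using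
    exists_sub_div_pow_mem_coeffComplement (O := O) (P := P) (d := d) (j := j) hd hdiv hloc
  have huniq' : ∀ h, ∀ b ∈ P, h - b / d ^ j ∈ coeffComplement O P d j → π h = b := by
    intro h b hb hN
    refine sub_eq_zero.1 (eq_zero_of_div_pow_mem_coeffComplement hd hdO hPO huniq hj
      (P.sub_mem (hπP h) hb) ?_)
    have := sub_mem hN (hπN h)
    rwa [sub_sub_sub_cancel_left, ← sub_div] at this
  refine ⟨AddMonoidHom.mk' π fun h h' => huniq' _ _ (P.add_mem (hπP h) (hπP h')) ?_, hπP,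
    fun h hh => huniq' _ _ P.zero_mem (by simpa using mem_coeffComplement_of_mem hh),
    fun b hb => huniq' _ _ hb (by simp), fun T hTO hTP h => huniq' _ _ (hTP _ _ (hπP h)) ?_⟩
  · rw [add_div, add_sub_add_comm]
    exact add_mem (hπN h) (hπN h')
  · rw [mul_div_cancel_left₀ _ (pow_ne_zero j hd), ← map_sub]
    exact map_mem_coeffComplement T hTO hd hTP (hπN h)

end coeff

section localization

open MvPolynomial

/-- The local ring of the prime `d` of `F[x]`, as a subring of `F(x)`. -/
def localSubring {F : Type*} [Field F] {n : ℕ} (d : MvPolynomial (Fin n) F) (hd : Prime d) :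
    Subring (MvRat F n) where
  carrier := {h | ∃ u v : MvPolynomial (Fin n) F, ¬ d ∣ v ∧
    h = algebraMap _ (MvRat F n) u / algebraMap _ (MvRat F n) v}
  zero_mem' := ⟨0, 1, fun h => hd.not_isUnit (isUnit_of_dvd_one h), by simp⟩
  one_mem' := ⟨1, 1, fun h => hd.not_isUnit (isUnit_of_dvd_one h), by simp⟩
  neg_mem' := by
    rintro _ ⟨u, v, hv, rfl⟩
    exact ⟨-u, v, hv, by rw [map_neg, neg_div]⟩
  mul_mem' := by
    rintro _ _ ⟨u, v, hv, rfl⟩ ⟨u', v', hv', rfl⟩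
    exact ⟨u * u', v * v', fun h => (hd.dvd_or_dvd h).elim hv hv',
      by rw [map_mul, map_mul, div_mul_div_comm]⟩
  add_mem' := by
    rintro _ _ ⟨u, v, hv, rfl⟩ ⟨u', v', hv', rfl⟩
    refine ⟨u * v' + v * u', v * v', fun h => (hd.dvd_or_dvd h).elim hv hv', ?_⟩
    have h0 : algebraMap _ (MvRat F n) v ≠ 0 :=
      (map_ne_zero_iff _ (IsFractionRing.injective _ _)).2 fun h => hv (h ▸ dvd_zero d)
    have h0' : algebraMap _ (MvRat F n) v' ≠ 0 :=
      (map_ne_zero_iff _ (IsFractionRing.injective _ _)).2 fun h => hv' (h ▸ dvd_zero d)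
    rw [div_add_div _ _ h0 h0']
    simp only [map_mul, map_add]

variable {F : Type*} [Field F] {n : ℕ}

theorem algebraMap_mvRat_injective :
    Function.Injective (algebraMap (MvPolynomial (Fin n) F) (MvRat F n)) :=
  IsFractionRing.injective _ _

theorem algebraMap_mvRat_ne_zero {p : MvPolynomial (Fin n) F} (hp : p ≠ 0) :
    algebraMap _ (MvRat F n) p ≠ 0 :=
  (map_ne_zero_iff _ algebraMap_mvRat_injective).2 hp

theorem algebraMap_mem_localSubring {d : MvPolynomial (Fin n) F} (hd : Prime d)
    (p : MvPolynomial (Fin n) F) : algebraMap _ (MvRat F n) p ∈ localSubring d hd :=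
  ⟨p, 1, fun h => hd.not_isUnit (isUnit_of_dvd_one h), by simp⟩

theorem inv_algebraMap_mem_localSubring {d : MvPolynomial (Fin n) F} (hd : Prime d)
    {p : MvPolynomial (Fin n) F} (hp : ¬ d ∣ p) :
    (algebraMap _ (MvRat F n) p)⁻¹ ∈ localSubring d hd :=
  ⟨1, p, hp, by simp⟩

theorem dvd_or_dvd_of_mul_mem_localSubring {d : MvPolynomial (Fin n) F} (hd : Prime d)
    {x y z : MvRat F n} (hx : x ∈ localSubring d hd) (hy : y ∈ localSubring d hd)
    (hz : z ∈ localSubring d hd) (h : x * y = algebraMap _ (MvRat F n) d * z) :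
    (∃ o ∈ localSubring d hd, x = algebraMap _ (MvRat F n) d * o) ∨
      ∃ o ∈ localSubring d hd, y = algebraMap _ (MvRat F n) d * o := by
  obtain ⟨u, v, hv, rfl⟩ := hx
  obtain ⟨u', v', hv', rfl⟩ := hy
  obtain ⟨s, t, ht, rfl⟩ := hz
  have hv0 := algebraMap_mvRat_ne_zero (fun h => hv (h ▸ dvd_zero d) : v ≠ 0)
  have hv0' := algebraMap_mvRat_ne_zero (fun h => hv' (h ▸ dvd_zero d) : v' ≠ 0)
  have ht0 := algebraMap_mvRat_ne_zero (fun h => ht (h ▸ dvd_zero d) : t ≠ 0)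
  have key : u * u' * t = d * (s * v * v') := by
    apply algebraMap_mvRat_injective
    simp only [map_mul]
    field_simp at h
    linear_combination h
  rcases hd.dvd_or_dvd ⟨_, key⟩ with h1 | h1
  · rcases hd.dvd_or_dvd h1 with ⟨w, rfl⟩ | ⟨w, rfl⟩
    · exact Or.inl ⟨_, ⟨w, v, hv, rfl⟩, by rw [map_mul, mul_div_assoc]⟩
    · exact Or.inr ⟨_, ⟨w, v', hv', rfl⟩, by rw [map_mul, mul_div_assoc]⟩
  · exact absurd h1 ht

theorem dvd_of_algebraMap_eq_mul {d : MvPolynomial (Fin n) F} (hd : Prime d)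
    {p : MvPolynomial (Fin n) F} {o : MvRat F n} (ho : o ∈ localSubring d hd)
    (h : algebraMap _ (MvRat F n) p = algebraMap _ (MvRat F n) d * o) : d ∣ p := by
  obtain ⟨u, v, hv, rfl⟩ := ho
  have hv0 := algebraMap_mvRat_ne_zero (fun h => hv (h ▸ dvd_zero d) : v ≠ 0)
  have key : p * v = d * u := by
    apply algebraMap_mvRat_injective
    simp only [map_mul]
    field_simp at h
    linear_combination h
  exact (hd.dvd_or_dvd ⟨_, key⟩).resolve_right hv

theorem exists_pow_mul_mem_localSubring {d : MvPolynomial (Fin n) F} (hd : Prime d)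
    (h : MvRat F n) : ∃ m : ℕ, algebraMap _ (MvRat F n) d ^ m * h ∈ localSubring d hd := by
  obtain ⟨u, v, hv, rfl⟩ := IsFractionRing.div_surjective (A := MvPolynomial (Fin n) F) h
  obtain ⟨m, w, hw, rfl⟩ := WfDvdMonoid.max_power_factor (nonZeroDivisors.ne_zero hv)
    hd.irreducible
  refine ⟨m, u, w, hw, ?_⟩
  have hd0 := algebraMap_mvRat_ne_zero hd.ne_zero
  rw [map_mul, map_pow, mul_div_assoc', mul_div_mul_left _ _ (pow_ne_zero m hd0)]

variable [NeZero n]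

theorem exists_div_of_mem_hatField {h : MvRat F n} (hh : h ∈ hatField F n) :
    ∃ s e : MvPolynomial (Fin n) F, e ≠ 0 ∧ s.degreeOf 0 = 0 ∧ e.degreeOf 0 = 0 ∧
      h = algebraMap _ (MvRat F n) s / algebraMap _ (MvRat F n) e := by
  have hmul : ∀ {p p' : MvPolynomial (Fin n) F}, p.degreeOf 0 = 0 → p'.degreeOf 0 = 0 →
      (p * p').degreeOf 0 = 0 := fun {p p'} hp hp' => by
    have := degreeOf_mul_le 0 p p'
    omega
  have hadd : ∀ {p p' : MvPolynomial (Fin n) F}, p.degreeOf 0 = 0 → p'.degreeOf 0 = 0 →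
      (p + p').degreeOf 0 = 0 := fun {p p'} hp hp' => by
    have := degreeOf_add_le 0 p p'
    simp_all
  have hone : (1 : MvPolynomial (Fin n) F).degreeOf 0 = 0 := degreeOf_C 1 0
  induction hh using Subfield.closure_induction with
  | mem x hx =>
    rcases hx with ⟨c, rfl⟩ | ⟨i, hi, rfl⟩
    · exact ⟨C c, 1, one_ne_zero, degreeOf_C c 0, hone, by
        rw [map_one, div_one, ← algebraMap_eq, ← IsScalarTower.algebraMap_apply]⟩
    · exact ⟨X i, 1, one_ne_zero, degreeOf_X_of_ne (Ne.symm hi), hone, by simp [xv]⟩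
  | one => exact ⟨1, 1, one_ne_zero, hone, hone, by simp⟩
  | add x y _ _ hx hy =>
    obtain ⟨s, e, he, hs0, he0, rfl⟩ := hx
    obtain ⟨s', e', he', hs0', he0', rfl⟩ := hy
    refine ⟨s * e' + e * s', e * e', mul_ne_zero he he', hadd (hmul hs0 he0') (hmul he0 hs0'),
      hmul he0 he0', ?_⟩
    rw [div_add_div _ _ (algebraMap_mvRat_ne_zero he) (algebraMap_mvRat_ne_zero he')]
    simp only [map_mul, map_add]
  | neg x _ hx =>
    obtain ⟨s, e, he, hs0, he0, rfl⟩ := hx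
    exact ⟨-s, e, he, by rwa [degreeOf_neg], he0, by rw [map_neg, neg_div]⟩
  | inv x _ hx =>
    obtain ⟨s, e, he, hs0, he0, rfl⟩ := hx
    rcases eq_or_ne s 0 with rfl | hs
    · exact ⟨0, 1, one_ne_zero, by simp, hone, by simp⟩
    · exact ⟨e, s, hs, he0, hs0, by rw [inv_div]⟩
  | mul x y _ _ hx hy =>
    obtain ⟨s, e, he, hs0, he0, rfl⟩ := hx
    obtain ⟨s', e', he', hs0', he0', rfl⟩ := hy
    exact ⟨s * s', e * e', mul_ne_zero he he', hmul hs0 hs0', hmul he0 he0',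
      by rw [map_mul, map_mul, div_mul_div_comm]⟩

theorem exists_div_of_isPolyDeg {D : ℕ} (hD : 0 < D) {h : MvRat F n}
    (hh : IsPolyDeg (hatField F n) (xv 0) D h) :
    ∃ s e : MvPolynomial (Fin n) F, e ≠ 0 ∧ s.degreeOf 0 < D ∧ e.degreeOf 0 = 0 ∧
      h = algebraMap _ (MvRat F n) s / algebraMap _ (MvRat F n) e := by
  obtain ⟨cf, rfl⟩ := hh
  refine Finset.sum_induction _ (fun h => ∃ s e : MvPolynomial (Fin n) F, e ≠ 0 ∧
    s.degreeOf 0 < D ∧ e.degreeOf 0 = 0 ∧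
      h = algebraMap _ (MvRat F n) s / algebraMap _ (MvRat F n) e) ?_ ?_ ?_
  · rintro _ _ ⟨s, e, he, hs0, he0, rfl⟩ ⟨s', e', he', hs0', he0', rfl⟩
    refine ⟨s * e' + e * s', e * e', mul_ne_zero he he', ?_, ?_, ?_⟩
    · have h1 := degreeOf_mul_le 0 s e'
      have h2 := degreeOf_mul_le 0 e s'
      have h3 := degreeOf_add_le 0 (s * e') (e * s')
      omega
    · have := degreeOf_mul_le 0 e e'
      omega
    · rw [div_add_div _ _ (algebraMap_mvRat_ne_zero he) (algebraMap_mvRat_ne_zero he')]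
      simp only [map_mul, map_add]
  · exact ⟨0, 1, one_ne_zero, by simpa using hD, degreeOf_C 1 0, by simp⟩
  · intro k _
    obtain ⟨s, e, he, hs0, he0, hse⟩ := exists_div_of_mem_hatField (cf k).2
    refine ⟨s * X 0 ^ (k : ℕ), e, he, ?_, he0, ?_⟩
    · have h1 := degreeOf_mul_le 0 s (X 0 ^ (k : ℕ))
      rw [degreeOf_X_self_pow] at h1
      omega
    · rw [hse, map_mul, map_pow, xv, div_mul_eq_mul_div]

theorem not_dvd_of_degreeOf_lt {d e : MvPolynomial (Fin n) F} (he : e ≠ 0)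
    (hlt : e.degreeOf 0 < d.degreeOf 0) : ¬ d ∣ e := by
  rintro ⟨w, rfl⟩
  rw [degreeOf_mul_eq (left_ne_zero_of_mul he) (right_ne_zero_of_mul he)] at hlt
  omega

theorem mem_localSubring_of_isPolyDeg {d : MvPolynomial (Fin n) F} (hd : Prime d)
    (hdeg : 0 < d.degreeOf 0) {D : ℕ} {b : MvRat F n}
    (hb : IsPolyDeg (hatField F n) (xv 0) D b) : b ∈ localSubring d hd := by
  rcases D.eq_zero_or_pos with rfl | hD
  · obtain ⟨cf, rfl⟩ := hb
    simp
  · obtain ⟨s, e, he, -, he0, rfl⟩ := exists_div_of_isPolyDeg hD hb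
    exact ⟨s, e, not_dvd_of_degreeOf_lt he (by omega), rfl⟩

theorem eq_zero_of_isPolyDeg_of_eq_mul {d : MvPolynomial (Fin n) F} (hd : Prime d)
    (hdeg : 0 < d.degreeOf 0) {b o : MvRat F n}
    (hb : IsPolyDeg (hatField F n) (xv 0) (d.degreeOf 0) b) (ho : o ∈ localSubring d hd)
    (h : b = algebraMap _ (MvRat F n) d * o) : b = 0 := by
  obtain ⟨s, e, he, hs, he0, rfl⟩ := exists_div_of_isPolyDeg hdeg hb
  have hdvd : d ∣ s := by
    refine dvd_of_algebraMap_eq_mul hd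
      ((localSubring d hd).mul_mem ho (algebraMap_mem_localSubring hd e)) ?_
    rw [← mul_assoc, ← h, div_mul_cancel₀ _ (algebraMap_mvRat_ne_zero he)]
  have : s = 0 := by
    by_contra hs0
    exact not_dvd_of_degreeOf_lt hs0 hs hdvd
  rw [this, map_zero, zero_div]

theorem isPolyDeg_iff_exists_polynomial {L : Type*} [Field L] {E : Subfield L} {x : L} {D : ℕ}
    {a : L} : IsPolyDeg E x D a ↔
      ∃ p : Polynomial E, p.degree < D ∧ Polynomial.aeval x p = a := by
  constructor
  · rintro ⟨cf, rfl⟩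
    refine ⟨∑ k : Fin D, Polynomial.C (cf k) * Polynomial.X ^ (k : ℕ), ?_, ?_⟩
    · rw [← Polynomial.mem_degreeLT]
      refine Submodule.sum_mem _ fun k _ => Polynomial.mem_degreeLT.2 ?_
      exact (Polynomial.degree_C_mul_X_pow_le _ _).trans_lt (by exact_mod_cast k.2)
    · rw [map_sum]
      refine Finset.sum_congr rfl fun k _ => ?_
      rw [map_mul, map_pow, Polynomial.aeval_C, Polynomial.aeval_X]
      rfl
  · rintro ⟨p, hp, rfl⟩
    refine ⟨fun k => p.coeff k, ?_⟩
    rcases eq_or_ne p 0 with rfl | h0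
    · simp
    · rw [Polynomial.aeval_eq_sum_range' ((Polynomial.natDegree_lt_iff_degree_lt h0).2 hp),
        Finset.sum_range]
      rfl

theorem exists_polynomial_aeval_eq (p : MvPolynomial (Fin n) F) :
    ∃ P : Polynomial (hatField F n), P.degree ≤ p.degreeOf 0 ∧
      Polynomial.aeval (xv 0 : MvRat F n) P = algebraMap _ (MvRat F n) p := by
  have hmem : ∀ (s : Fin n →₀ ℕ) (c : F),
      algebraMap F (MvRat F n) c * ∏ i ∈ Finset.univ.erase 0, xv i ^ s i ∈ hatField F n := by
    intro s c
    refine mul_mem (Subfield.subset_closure (Or.inl ⟨c, rfl⟩)) (prod_mem fun i hi => pow_mem ?_ _)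
    exact Subfield.subset_closure (Or.inr ⟨i, Finset.ne_of_mem_erase hi, rfl⟩)
  refine ⟨∑ s ∈ p.support, Polynomial.C ⟨_, hmem s (p.coeff s)⟩ * Polynomial.X ^ (s 0), ?_, ?_⟩
  · rw [← Polynomial.mem_degreeLE]
    refine Submodule.sum_mem _ fun s hs => Polynomial.mem_degreeLE.2 ?_
    exact (Polynomial.degree_C_mul_X_pow_le _ _).trans
      (by exact_mod_cast monomial_le_degreeOf 0 hs)
  · conv_rhs => rw [p.as_sum]
    rw [map_sum, map_sum]
    refine Finset.sum_congr rfl fun s _ => ?_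
    rw [map_mul, map_pow, Polynomial.aeval_C, Polynomial.aeval_X, monomial_eq,
      Finsupp.prod_fintype _ _ fun i => pow_zero _, map_mul, map_prod,
      ← Finset.mul_prod_erase _ _ (Finset.mem_univ 0), ← algebraMap_eq,
      ← IsScalarTower.algebraMap_apply]
    simp only [map_pow]
    change algebraMap F (MvRat F n) _ * _ * _ = algebraMap F (MvRat F n) _ * (xv 0 ^ s 0 * _)
    rw [mul_assoc, mul_comm (xv 0 ^ s 0)]
    rfl

theorem exists_isPolyDeg_add_mul {d : MvPolynomial (Fin n) F} (hd : Prime d)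
    (hdeg : 0 < d.degreeOf 0) {o : MvRat F n} (ho : o ∈ localSubring d hd) :
    ∃ b, IsPolyDeg (hatField F n) (xv 0) (d.degreeOf 0) b ∧ ∃ o' ∈ localSubring d hd,
      o = b + algebraMap _ (MvRat F n) d * o' := by
  classical
  have hev : ∀ P : Polynomial (hatField F n),
      Polynomial.aeval (xv 0 : MvRat F n) P ∈ localSubring d hd := fun P =>
    mem_localSubring_of_isPolyDeg hd hdeg (isPolyDeg_iff_exists_polynomial.2
      ⟨P, P.degree_le_natDegree.trans_lt (by exact_mod_cast P.natDegree.lt_succ_self), rfl⟩)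
  obtain ⟨u, v, hv, rfl⟩ := ho
  have hv0 := algebraMap_mvRat_ne_zero (fun h => hv (h ▸ dvd_zero d) : v ≠ 0)
  obtain ⟨du, -, hdu⟩ := exists_polynomial_aeval_eq u
  obtain ⟨dv, -, hdv⟩ := exists_polynomial_aeval_eq v
  obtain ⟨dd, hddeg, hdd⟩ := exists_polynomial_aeval_eq d
  have hdd0 : dd ≠ 0 := by
    rintro rfl
    rw [map_zero] at hdd
    exact algebraMap_mvRat_ne_zero hd.ne_zero hdd.symm
  have hcop : IsCoprime dv dd := by
    rw [← EuclideanDomain.gcd_isUnit_iff]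
    obtain ⟨w, hw⟩ := EuclideanDomain.gcd_dvd_right dv dd
    obtain ⟨z, hz⟩ := EuclideanDomain.gcd_dvd_left dv dd
    set g := EuclideanDomain.gcd dv dd
    have hw0 : w ≠ 0 := by
      rintro rfl
      exact hdd0 (by rw [hw, mul_zero])
    have hg0 : g ≠ 0 := by
      rintro hg
      exact hdd0 (by rw [hw, hg, zero_mul])
    have hprod : Polynomial.aeval (xv 0 : MvRat F n) g * Polynomial.aeval (xv 0 : MvRat F n) w =
        algebraMap _ (MvRat F n) d * 1 := by
      rw [← map_mul, ← hw, hdd, mul_one]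
    rcases dvd_or_dvd_of_mul_mem_localSubring hd (hev g) (hev w) (localSubring d hd).one_mem hprod
      with ⟨o, ho, hgo⟩ | ⟨o, ho, hwo⟩
    · refine absurd (dvd_of_algebraMap_eq_mul hd
        ((localSubring d hd).mul_mem ho (hev z)) ?_) hv
      rw [← hdv, hz, map_mul, hgo, mul_assoc]
    · have hwdeg : ¬ w.degree < d.degreeOf 0 := by
        intro hlt
        have h0 := eq_zero_of_isPolyDeg_of_eq_mul hd hdeg
          (isPolyDeg_iff_exists_polynomial.2 ⟨w, hlt, rfl⟩) ho hwo
        rw [h0, mul_zero, mul_one] at hprod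
        exact algebraMap_mvRat_ne_zero hd.ne_zero hprod.symm
      rw [Polynomial.isUnit_iff_degree_eq_zero]
      rw [hw, Polynomial.degree_mul, Polynomial.degree_eq_natDegree hg0,
        Polynomial.degree_eq_natDegree hw0] at hddeg
      rw [Polynomial.degree_eq_natDegree hw0] at hwdeg
      rw [Polynomial.degree_eq_natDegree hg0]
      norm_cast at *
      omega
  obtain ⟨A, B, hAB⟩ := hcop
  refine ⟨Polynomial.aeval (xv 0) (du * A % dd), isPolyDeg_iff_exists_polynomial.2
    ⟨_, (EuclideanDomain.mod_lt _ hdd0).trans_le hddeg, rfl⟩,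
    Polynomial.aeval (xv 0) (du * A / dd) + Polynomial.aeval (xv 0) (du * B) *
      (algebraMap _ (MvRat F n) v)⁻¹, ?_, ?_⟩
  · exact (localSubring d hd).add_mem (hev _) ((localSubring d hd).mul_mem (hev _)
      (inv_algebraMap_mem_localSubring hd hv))
  · have h1 := congrArg (Polynomial.aeval (xv 0 : MvRat F n))
      (EuclideanDomain.div_add_mod (du * A) dd)
    have h2 := congrArg (Polynomial.aeval (xv 0 : MvRat F n)) hAB
    simp only [map_add, map_mul, map_one, hdu, hdv, hdd] at h1 h2 ⊢
    field_simp
    linear_combination (-algebraMap _ (MvRat F n) u) * h2 - algebraMap _ (MvRat F n) v * h1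

end localization

section sums

variable {Γ L ι : Type*} [AddCommGroup Γ] [AddCommGroup L] [Fintype ι]

/-- The subgroup of sums of differences `T (γ i) (g i) - g i` with all `g i` in `P`. -/
def sumSubgroup (T : Γ → L →+ L) (γ : ι → Γ) (P : AddSubgroup L) : AddSubgroup L where
  carrier := {h | ∃ g : ι → L, (∀ i, g i ∈ P) ∧ h = ∑ i, (T (γ i) (g i) - g i)}
  zero_mem' := ⟨0, fun _ => P.zero_mem, by simp⟩
  add_mem' := by
    rintro _ _ ⟨g, hg, rfl⟩ ⟨g', hg', rfl⟩
    refine ⟨g + g', fun i => P.add_mem (hg i) (hg' i), ?_⟩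
    simp only [Pi.add_apply, map_add, add_sub_add_comm, Finset.sum_add_distrib]
  neg_mem' := by
    rintro _ ⟨g, hg, rfl⟩
    refine ⟨-g, fun i => P.neg_mem (hg i), ?_⟩
    simp only [Pi.neg_apply, map_neg, neg_sub_neg, ← Finset.sum_neg_distrib, neg_sub]

theorem sub_mem_sumSubgroup (T : Γ → L →+ L) (hT0 : ∀ h, T 0 h = h)
    (hTadd : ∀ β γ h, T (β + γ) h = T β (T γ h)) (γ : ι → Γ) (P : AddSubgroup L)
    (hP : ∀ β ∈ AddSubgroup.closure (Set.range γ), ∀ h ∈ P, T β h ∈ P)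
    {β : Γ} (hβ : β ∈ AddSubgroup.closure (Set.range γ)) :
    ∀ h ∈ P, T β h - h ∈ sumSubgroup T γ P := by
  classical
  induction hβ using AddSubgroup.closure_induction with
  | mem _ hx =>
    obtain ⟨i, rfl⟩ := hx
    intro h hh
    refine ⟨Pi.single i h, fun k => ?_, ?_⟩
    · rcases eq_or_ne k i with rfl | hk
      · rwa [Pi.single_eq_same]
      · rw [Pi.single_eq_of_ne hk]
        exact P.zero_mem
    · rw [Finset.sum_eq_single i]
      · rw [Pi.single_eq_same]
      · intro k _ hk
        rw [Pi.single_eq_of_ne hk, map_zero, sub_zero]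
      · simp
  | zero =>
    intro h _
    rw [hT0, sub_self]
    exact zero_mem _
  | add x y _ hyc hx hy =>
    intro h hh
    have := add_mem (hx _ (hP y hyc h hh)) (hy h hh)
    rwa [sub_add_sub_cancel, ← hTadd] at this
  | neg x hxc hx =>
    intro h hh
    have := neg_mem (hx _ (hP (-x) (neg_mem hxc) h hh))
    rwa [neg_sub, ← hTadd, add_neg_cancel, hT0] at this

end sums

theorem mem_closure_range_of_eq_sum_smul {Γ ι : Type*} [AddCommGroup Γ] [Fintype ι] {γ : ι → Γ}
    {β : Γ} (t : ι → ℤ) (h : β = ∑ i, t i • γ i) : β ∈ AddSubgroup.closure (Set.range γ) :=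
  h ▸ sum_mem fun i _ => zsmul_mem (AddSubgroup.subset_closure (Set.mem_range_self i)) _

section thetaPowS

variable {F L ι : Type*} [CommSemiring F] [Semiring L] [Algebra F L] [Fintype ι]
  {θ : ι → (L ≃ₐ[F] L)}

theorem thetaPowS_zero : thetaPowS θ 0 = 1 := by
  simp [thetaPowS]

theorem thetaPowS_single [DecidableEq ι] (i : ι) : thetaPowS θ (Pi.single i 1) = θ i := by
  rw [thetaPowS, List.prod_map_eq_pow_single i]
  · rw [List.count_eq_one_of_mem (Finset.nodup_toList _) (by simp)]
    simp
  · intro k hk _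
    rw [Pi.single_eq_of_ne hk, zpow_zero]

theorem thetaPowS_add (hcomm : ∀ i k, Commute (θ i) (θ k)) (α β : ι → ℤ) :
    thetaPowS θ (α + β) = thetaPowS θ α * thetaPowS θ β := by
  unfold thetaPowS
  induction (Finset.univ : Finset ι).toList with
  | nil => simp
  | cons i l ih =>
    have h : Commute (θ i ^ β i) (l.map fun i => θ i ^ α i).prod :=
      Commute.list_prod_right _ _ fun x hx => by
        obtain ⟨k, -, rfl⟩ := List.mem_map.1 hx
        exact (hcomm i k).zpow_zpow _ _
    simp only [List.map_cons, List.prod_cons]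
    rw [ih, Pi.add_apply, zpow_add, mul_assoc, ← mul_assoc (θ i ^ β i), h.eq]
    simp only [mul_assoc]

end thetaPowS

section affine

open MvPolynomial

/-- The automorphisms of `F(x)` that act on each variable by an affine substitution. -/
def affineSubgroup (F : Type*) [Field F] (n : ℕ) : Subgroup (MvRat F n ≃ₐ[F] MvRat F n) where
  carrier := {φ | ∀ l : Fin n, ∃ u w : F, u ≠ 0 ∧
    φ (xv l) = algebraMap F (MvRat F n) u * xv l + algebraMap F (MvRat F n) w}
  one_mem' := fun l => ⟨1, 0, one_ne_zero, by simp⟩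
  mul_mem' := by
    intro φ ψ hφ hψ l
    obtain ⟨u, w, hu, h⟩ := hφ l
    obtain ⟨u', w', hu', h'⟩ := hψ l
    refine ⟨u' * u, u' * w + w', mul_ne_zero hu' hu, ?_⟩
    rw [AlgEquiv.mul_apply, h', map_add, map_mul, AlgEquiv.commutes, AlgEquiv.commutes, h]
    simp only [map_mul, map_add]
    ring
  inv_mem' := by
    intro φ hφ l
    obtain ⟨u, w, hu, h⟩ := hφ l
    have hu' : algebraMap F (MvRat F n) u ≠ 0 := (map_ne_zero _).2 hu
    refine ⟨u⁻¹, -(u⁻¹ * w), inv_ne_zero hu, ?_⟩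
    have h1 : φ⁻¹ (φ (xv l)) =
        φ⁻¹ (algebraMap F (MvRat F n) u * xv l + algebraMap F (MvRat F n) w) := by rw [h]
    rw [map_add, map_mul, AlgEquiv.commutes, AlgEquiv.commutes, ← AlgEquiv.mul_apply,
      inv_mul_cancel, AlgEquiv.one_apply] at h1
    simp only [map_mul, map_neg, map_inv₀]
    field_simp
    linear_combination -h1

variable {F : Type*} [Field F] {n : ℕ}

theorem exists_algebraMap_eq_apply {φ : MvRat F n ≃ₐ[F] MvRat F n} (hφ : φ ∈ affineSubgroup F n)
    (p : MvPolynomial (Fin n) F) :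
    ∃ p' : MvPolynomial (Fin n) F,
      φ (algebraMap _ (MvRat F n) p) = algebraMap _ (MvRat F n) p' := by
  have hC : ∀ c : F, algebraMap (MvPolynomial (Fin n) F) (MvRat F n) (C c) =
      algebraMap F (MvRat F n) c := fun c => by
    rw [← algebraMap_eq, ← IsScalarTower.algebraMap_apply]
  induction p using MvPolynomial.induction_on with
  | C c => exact ⟨C c, by rw [hC, AlgEquiv.commutes]⟩
  | add p q hp hq =>
    obtain ⟨p', hp⟩ := hp
    obtain ⟨q', hq⟩ := hq
    exact ⟨p' + q', by rw [map_add, map_add, hp, hq, map_add]⟩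
  | mul_X p l hp =>
    obtain ⟨p', hp⟩ := hp
    obtain ⟨u, w, -, h⟩ := hφ l
    refine ⟨p' * (C u * X l + C w), ?_⟩
    rw [map_mul, map_mul, hp, map_mul, map_add, map_mul, hC, hC]
    exact congrArg _ h

theorem algEquiv_mvRat_ext {φ ψ : MvRat F n ≃ₐ[F] MvRat F n}
    (h : ∀ l : Fin n, φ (xv l) = ψ (xv l)) : φ = ψ := by
  have hR : ∀ p : MvPolynomial (Fin n) F,
      φ (algebraMap _ (MvRat F n) p) = ψ (algebraMap _ (MvRat F n) p) := by
    intro p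
    have : (φ.toAlgHom.comp (IsScalarTower.toAlgHom F (MvPolynomial (Fin n) F) (MvRat F n))) =
        ψ.toAlgHom.comp (IsScalarTower.toAlgHom F (MvPolynomial (Fin n) F) (MvRat F n)) :=
      MvPolynomial.algHom_ext h
    exact DFunLike.congr_fun this p
  ext x
  obtain ⟨u, v, -, rfl⟩ := IsFractionRing.div_surjective (A := MvPolynomial (Fin n) F) x
  rw [map_div₀, map_div₀, hR, hR]

theorem thetaPowS_mem_affineSubgroup {θ : Fin n → (MvRat F n ≃ₐ[F] MvRat F n)}
    (hθ : ∀ i, θ i ∈ affineSubgroup F n) (β : Fin n → ℤ) :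
    thetaPowS θ β ∈ affineSubgroup F n := by
  refine Subgroup.list_prod_mem _ fun x hx => ?_
  obtain ⟨i, -, rfl⟩ := List.mem_map.1 hx
  exact zpow_mem (hθ i) _

theorem isUnit_iff_exists_algebraMap_eq {w : MvPolynomial (Fin n) F} :
    IsUnit w ↔ ∃ c : F, c ≠ 0 ∧ algebraMap _ (MvRat F n) w = algebraMap F (MvRat F n) c := by
  have hC : ∀ c : F, algebraMap (MvPolynomial (Fin n) F) (MvRat F n) (C c) =
      algebraMap F (MvRat F n) c := fun c => by
    rw [← algebraMap_eq, ← IsScalarTower.algebraMap_apply]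
  rw [isUnit_iff_eq_C_of_isReduced]
  constructor
  · rintro ⟨c, hc, rfl⟩
    exact ⟨c, hc.ne_zero, hC c⟩
  · rintro ⟨c, hc, h⟩
    exact ⟨c, hc.isUnit, algebraMap_mvRat_injective (h.trans (hC c).symm)⟩

theorem isUnit_of_apply_eq {φ : MvRat F n ≃ₐ[F] MvRat F n} {p p' : MvPolynomial (Fin n) F}
    (h : φ (algebraMap _ (MvRat F n) p) = algebraMap _ (MvRat F n) p') (hp' : IsUnit p') :
    IsUnit p := by
  obtain ⟨c, hc, hcp⟩ := isUnit_iff_exists_algebraMap_eq.1 hp'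
  refine isUnit_iff_exists_algebraMap_eq.2 ⟨c, hc, φ.injective ?_⟩
  rw [h, hcp, AlgEquiv.commutes]

theorem irreducible_of_apply_eq {φ : MvRat F n ≃ₐ[F] MvRat F n} (hφ : φ ∈ affineSubgroup F n)
    {d d' : MvPolynomial (Fin n) F} (hd : Irreducible d)
    (h : φ (algebraMap _ (MvRat F n) d) = algebraMap _ (MvRat F n) d') : Irreducible d' := by
  have hinv : ∀ {p p' : MvPolynomial (Fin n) F},
      φ⁻¹ (algebraMap _ (MvRat F n) p) = algebraMap _ (MvRat F n) p' →
      φ (algebraMap _ (MvRat F n) p') = algebraMap _ (MvRat F n) p := fun h => by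
    rw [← h, ← AlgEquiv.mul_apply, mul_inv_cancel, AlgEquiv.one_apply]
  refine ⟨fun hu => hd.not_isUnit (isUnit_of_apply_eq h hu), fun s t hst => ?_⟩
  obtain ⟨s', hs⟩ := exists_algebraMap_eq_apply (inv_mem hφ) s
  obtain ⟨t', ht⟩ := exists_algebraMap_eq_apply (inv_mem hφ) t
  have hst' : d = s' * t' := by
    apply algebraMap_mvRat_injective
    apply φ.injective
    rw [h, hst, map_mul, map_mul, map_mul, hinv hs, hinv ht]
  exact (hd.isUnit_or_isUnit hst').imp (isUnit_of_apply_eq hs) (isUnit_of_apply_eq ht)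

theorem exists_eq_mul_of_associated {p p' : MvPolynomial (Fin n) F} (h : Associated p p') :
    ∃ c : F, c ≠ 0 ∧ algebraMap _ (MvRat F n) p' =
      algebraMap F (MvRat F n) c * algebraMap _ (MvRat F n) p := by
  obtain ⟨w, rfl⟩ := h
  obtain ⟨c, hc, hcw⟩ := isUnit_iff_exists_algebraMap_eq.1 w.isUnit
  exact ⟨c, hc, by rw [map_mul, hcw, mul_comm]⟩

theorem apply_mem_localSubring {φ : MvRat F n ≃ₐ[F] MvRat F n} (hφ : φ ∈ affineSubgroup F n)
    {d : MvPolynomial (Fin n) F} (hd : Prime d) {c : F} (hc : c ≠ 0)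
    (h : φ (algebraMap _ (MvRat F n) d) =
      algebraMap F (MvRat F n) c * algebraMap _ (MvRat F n) d)
    {x : MvRat F n} (hx : x ∈ localSubring d hd) : φ x ∈ localSubring d hd := by
  obtain ⟨u, v, hv, rfl⟩ := hx
  obtain ⟨u', hu⟩ := exists_algebraMap_eq_apply hφ u
  obtain ⟨v', hv'⟩ := exists_algebraMap_eq_apply hφ v
  refine ⟨u', v', ?_, by rw [map_div₀, hu, hv']⟩
  rintro ⟨w, rfl⟩
  obtain ⟨w', hw⟩ := exists_algebraMap_eq_apply (inv_mem hφ) w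
  refine hv ⟨C c⁻¹ * w', ?_⟩
  apply algebraMap_mvRat_injective
  apply φ.injective
  have hc' : algebraMap F (MvRat F n) c ≠ 0 := (map_ne_zero _).2 hc
  have hC : algebraMap (MvPolynomial (Fin n) F) (MvRat F n) (C c⁻¹) =
      algebraMap F (MvRat F n) c⁻¹ := by
    rw [← algebraMap_eq, ← IsScalarTower.algebraMap_apply]
  rw [hv', map_mul, map_mul, map_mul, map_mul, map_mul, h, hC, AlgEquiv.commutes, ← hw,
    ← AlgEquiv.mul_apply, mul_inv_cancel, AlgEquiv.one_apply, map_inv₀]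
  field_simp

variable [NeZero n]

theorem algebraMap_mem_hatField (c : F) : algebraMap F (MvRat F n) c ∈ hatField F n :=
  Subfield.subset_closure (Or.inl ⟨c, rfl⟩)

theorem apply_mem_hatField {φ : MvRat F n ≃ₐ[F] MvRat F n} (hφ : φ ∈ affineSubgroup F n)
    {x : MvRat F n} (hx : x ∈ hatField F n) : φ x ∈ hatField F n := by
  refine (Subfield.closure_le
    (t := (hatField F n).comap (φ : MvRat F n →+* MvRat F n))).2 ?_ hx
  rintro _ (⟨c, rfl⟩ | ⟨i, hi, rfl⟩)
  · change φ _ ∈ hatField F n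
    rw [AlgEquiv.commutes]
    exact algebraMap_mem_hatField c
  · change φ _ ∈ hatField F n
    obtain ⟨u, w, -, h⟩ := hφ i
    rw [h]
    exact add_mem (mul_mem (algebraMap_mem_hatField u)
      (Subfield.subset_closure (Or.inr ⟨i, hi, rfl⟩))) (algebraMap_mem_hatField w)

/-- The additive group of polynomials in `x` over `E` of degree `< D`. -/
def polyDegSubgroup {L : Type*} [Field L] (E : Subfield L) (x : L) (D : ℕ) : AddSubgroup L where
  carrier := {a | IsPolyDeg E x D a}
  zero_mem' := ⟨0, by simp⟩
  add_mem' := by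
    rintro _ _ ⟨cf, rfl⟩ ⟨cf', rfl⟩
    exact ⟨cf + cf', by simp [add_mul, Finset.sum_add_distrib]⟩
  neg_mem' := by
    rintro _ ⟨cf, rfl⟩
    exact ⟨-cf, by simp⟩

theorem mul_mem_polyDegSubgroup {L : Type*} [Field L] {E : Subfield L} {x : L} {D : ℕ} {e a : L}
    (he : e ∈ E) (ha : a ∈ polyDegSubgroup E x D) : e * a ∈ polyDegSubgroup E x D := by
  obtain ⟨cf, rfl⟩ := ha
  exact ⟨fun k => ⟨e, he⟩ * cf k, by simp [Finset.mul_sum, mul_assoc]⟩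

theorem apply_mem_polyDegSubgroup {φ : MvRat F n ≃ₐ[F] MvRat F n}
    (hφ : φ ∈ affineSubgroup F n) {D : ℕ} {a : MvRat F n}
    (ha : a ∈ polyDegSubgroup (hatField F n) (xv 0) D) :
    φ a ∈ polyDegSubgroup (hatField F n) (xv 0) D := by
  obtain ⟨cf, rfl⟩ := ha
  obtain ⟨u, w, -, h⟩ := hφ 0
  rw [map_sum]
  refine sum_mem fun k _ => ?_
  rw [map_mul, map_pow, h]
  refine mul_mem_polyDegSubgroup (apply_mem_hatField hφ (cf k).2)
    (isPolyDeg_iff_exists_polynomial.2 ⟨(Polynomial.C ⟨_, algebraMap_mem_hatField u⟩ *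
      Polynomial.X + Polynomial.C ⟨_, algebraMap_mem_hatField w⟩) ^ (k : ℕ), ?_, ?_⟩)
  · refine (Polynomial.degree_pow_le_of_le _ Polynomial.degree_linear_le).trans_lt ?_
    rw [mul_one]
    exact_mod_cast k.2
  · rw [map_pow, map_add, map_mul, Polynomial.aeval_C, Polynomial.aeval_C, Polynomial.aeval_X]
    rfl

end affine

section twist

variable {F : Type*} [Field F] {n : ℕ}

/-- The operator `(c θ)^β = c^β θ_x^β` on `F(x)`. -/
noncomputable def twist (θ : Fin n → (MvRat F n ≃ₐ[F] MvRat F n)) (c : Fin n → F) (β : Fin n → ℤ) :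
    MvRat F n →+ MvRat F n :=
  (AddMonoidHom.mulLeft (algebraMap F (MvRat F n) (∏ l, c l ^ β l))).comp
    (thetaPowS θ β : MvRat F n →+ MvRat F n)

variable {θ : Fin n → (MvRat F n ≃ₐ[F] MvRat F n)} {c : Fin n → F}

theorem twist_apply (β : Fin n → ℤ) (h : MvRat F n) :
    twist θ c β h = algebraMap F (MvRat F n) (∏ l, c l ^ β l) * thetaPowS θ β h := rfl

theorem twist_zero (h : MvRat F n) : twist θ c 0 h = h := by
  simp [twist_apply, thetaPowS_zero]

theorem twist_add (hcomm : ∀ i k, Commute (θ i) (θ k)) (hc : ∀ i, c i ≠ 0)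
    (β γ : Fin n → ℤ) (h : MvRat F n) : twist θ c (β + γ) h = twist θ c β (twist θ c γ h) := by
  simp only [twist_apply, map_mul, AlgEquiv.commutes, thetaPowS_add hcomm, AlgEquiv.mul_apply,
    Pi.add_apply, zpow_add₀ (hc _), Finset.prod_mul_distrib, mul_assoc]

theorem twist_single (i : Fin n) (h : MvRat F n) :
    twist θ c (Pi.single i 1) h = algebraMap F (MvRat F n) (c i) * θ i h := by
  rw [twist_apply, thetaPowS_single, Finset.prod_eq_single i]
  · rw [Pi.single_eq_same, zpow_one]
  · intro k _ hk
    rw [Pi.single_eq_of_ne hk, zpow_zero]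
  · simp

theorem pow_mul_twist_div_pow {β : Fin n → ℤ} {d : MvRat F n} (hd : d ≠ 0) {e : F}
    (h : thetaPowS θ β d = algebraMap F (MvRat F n) e * d) (k : ℕ) (b : MvRat F n) :
    d ^ k * twist θ c β (b / d ^ k) =
      algebraMap F (MvRat F n) (e ^ (-(k : ℤ)) * ∏ l, c l ^ β l) * thetaPowS θ β b := by
  rw [twist_apply, map_div₀, map_pow, h, mul_pow, map_mul, zpow_neg, zpow_natCast, map_inv₀,
    map_pow]
  field_simp

/-- The conjugate of `twist θ c β` by multiplication with `d ^ j`. -/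
noncomputable def conjTwist (θ : Fin n → (MvRat F n ≃ₐ[F] MvRat F n)) (c : Fin n → F) (d : MvRat F n) (j : ℕ)
    (β : Fin n → ℤ) : MvRat F n →+ MvRat F n :=
  (AddMonoidHom.mulLeft (d ^ j)).comp
    ((twist θ c β).comp (AddMonoidHom.mulRight (d ^ j)⁻¹))

theorem conjTwist_apply (d : MvRat F n) (j : ℕ) (β : Fin n → ℤ) (b : MvRat F n) :
    conjTwist θ c d j β b = d ^ j * twist θ c β (b / d ^ j) := by
  simp [conjTwist, div_eq_mul_inv]

theorem commute_of_fix (hθfix : ∀ i l : Fin n, i ≠ l → θ i (xv l) = xv l)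
    (hθ : ∀ i, θ i ∈ affineSubgroup F n) (i k : Fin n) : Commute (θ i) (θ k) := by
  rcases eq_or_ne i k with rfl | hik
  · exact Commute.refl _
  refine algEquiv_mvRat_ext fun l => ?_
  rw [AlgEquiv.mul_apply, AlgEquiv.mul_apply]
  obtain ⟨u, w, -, h⟩ := hθ i l
  obtain ⟨u', w', -, h'⟩ := hθ k l
  rcases eq_or_ne i l with rfl | hil
  · rw [hθfix k i hik.symm, h, map_add, map_mul, AlgEquiv.commutes, AlgEquiv.commutes,
      hθfix k i hik.symm]
  · rw [hθfix i l hil, h', map_add, map_mul, AlgEquiv.commutes, AlgEquiv.commutes,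
      hθfix i l hil]

variable {d : MvPolynomial (Fin n) F}

theorem mem_isotropyZ_of_associated
    (hadd : ∀ α β, thetaPowS θ (α + β) = thetaPowS θ α * thetaPowS θ β)
    {β γ : Fin n → ℤ} {p p' : MvPolynomial (Fin n) F}
    (hp : thetaPowS θ β (algebraMap _ (MvRat F n) d) = algebraMap _ (MvRat F n) p)
    (hp' : thetaPowS θ γ (algebraMap _ (MvRat F n) d) = algebraMap _ (MvRat F n) p')
    (h : Associated p p') :
    -β + γ ∈ isotropyZ (thetaPowS θ) hadd thetaPowS_zero (algebraMap _ (MvRat F n) d) := by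
  obtain ⟨e, he, hpe⟩ := exists_eq_mul_of_associated h
  refine ⟨e, he, ?_⟩
  rw [hadd, AlgEquiv.mul_apply, hp', hpe, map_mul, AlgEquiv.commutes, ← hp,
    ← AlgEquiv.mul_apply, ← hadd, neg_add_cancel, thetaPowS_zero, AlgEquiv.one_apply]

theorem finite_setOf_not_mem_localSubring
    (hadd : ∀ α β, thetaPowS θ (α + β) = thetaPowS θ α * thetaPowS θ β)
    (hθ : ∀ i, θ i ∈ affineSubgroup F n) (hd : Prime d) (h : MvRat F n) :
    {x : (Fin n → ℤ) ⧸
        isotropyZ (thetaPowS θ) hadd thetaPowS_zero (algebraMap _ (MvRat F n) d) |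
      ∃ β : Fin n → ℤ, (β : _ ⧸ _) = x ∧ twist θ c (-β) h ∉ localSubring d hd}.Finite := by
  obtain ⟨u, v, hv, rfl⟩ := IsFractionRing.div_surjective (A := MvPolynomial (Fin n) F) h
  have hv0 := nonZeroDivisors.ne_zero hv
  have hmem := thetaPowS_mem_affineSubgroup hθ
  choose p hp using fun β => exists_algebraMap_eq_apply (hmem β) d
  have hdvd : ∀ β, twist θ c (-β) (algebraMap _ (MvRat F n) u / algebraMap _ (MvRat F n) v) ∉
      localSubring d hd → p β ∣ v := by
    intro β hβ
    by_contra hpv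
    obtain ⟨u', hu'⟩ := exists_algebraMap_eq_apply (hmem (-β)) u
    obtain ⟨v', hv'⟩ := exists_algebraMap_eq_apply (hmem (-β)) v
    refine hβ ?_
    rw [twist_apply, map_div₀, hu', hv']
    refine (localSubring d hd).mul_mem ?_ ⟨u', v', ?_, rfl⟩
    · rw [IsScalarTower.algebraMap_apply F (MvPolynomial (Fin n) F)]
      exact algebraMap_mem_localSubring hd _
    · rintro ⟨w, rfl⟩
      obtain ⟨w', hw'⟩ := exists_algebraMap_eq_apply (hmem β) w
      refine hpv ⟨w', algebraMap_mvRat_injective ?_⟩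
      rw [map_mul, ← hp, ← hw', ← map_mul, ← map_mul, ← hv', ← AlgEquiv.mul_apply, ← hadd,
        add_neg_cancel, thetaPowS_zero, AlgEquiv.one_apply]
  have hfin : {y : Associates (MvPolynomial (Fin n) F) | y ∣ Associates.mk v}.Finite := by
    let : Fintype (Associates (MvPolynomial (Fin n) F))ˣ := Fintype.ofFinite _
    exact Set.finite_coe_iff.1 (@Finite.of_fintype _
      (UniqueFactorizationMonoid.fintypeSubtypeDvd (Associates.mk v)
        (Associates.mk_ne_zero.2 hv0)))
  classical
  refine (hfin.image fun y => if hy : ∃ β, Associates.mk (p β) = y then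
    (hy.choose : (Fin n → ℤ) ⧸ _) else 0).subset ?_
  rintro _ ⟨β, rfl, hβ⟩
  refine ⟨Associates.mk (p β), Associates.mk_dvd_mk.2 (hdvd β hβ), ?_⟩
  have hy : ∃ γ, Associates.mk (p γ) = Associates.mk (p β) := ⟨β, rfl⟩
  simp only [dif_pos hy]
  exact QuotientAddGroup.eq.2 (mem_isotropyZ_of_associated hadd (hp _) (hp β)
    (Associates.mk_eq_mk_iff_associated.1 hy.choose_spec))

end twist

section criterion

variable {F : Type*} [Field F] {n : ℕ} {θ : Fin n → (MvRat F n ≃ₐ[F] MvRat F n)} {c : Fin n → F}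

theorem exists_eq_sum_of_twist_sub (hcomm : ∀ i k, Commute (θ i) (θ k)) (hc : ∀ i, c i ≠ 0)
    {r : ℕ} (α : Fin r → Fin n → ℤ) (b : Fin r → MvRat F n) :
    ∃ g : Fin n → MvRat F n, ∑ i, (twist θ c (α i) (b i) - b i) =
      ∑ i, (algebraMap F (MvRat F n) (c i) * θ i (g i) - g i) := by
  have hmem : ∑ i, (twist θ c (α i) (b i) - b i) ∈
      sumSubgroup (twist θ c) (fun i : Fin n => Pi.single i (1 : ℤ)) ⊤ := by
    refine sum_mem fun i _ => sub_mem_sumSubgroup _ twist_zero (twist_add hcomm hc) _ ⊤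
      (fun _ _ _ _ => AddSubgroup.mem_top _) ?_ _ (AddSubgroup.mem_top _)
    refine mem_closure_range_of_eq_sum_smul (α i) ?_
    conv_lhs => rw [← Finset.univ_sum_single (α i)]
    refine Finset.sum_congr rfl fun k _ => ?_
    rw [← Pi.single_smul, smul_eq_mul, mul_one]
  obtain ⟨g, -, hg⟩ := hmem
  exact ⟨g, by simpa only [twist_single] using hg⟩

variable {d : MvPolynomial (Fin n) F}

theorem twist_mem_localSubring (hθ : ∀ i, θ i ∈ affineSubgroup F n) (hd : Prime d)
    {β : Fin n → ℤ} {e : F} (he : e ≠ 0) (h : thetaPowS θ β (algebraMap _ (MvRat F n) d) =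
      algebraMap F (MvRat F n) e * algebraMap _ (MvRat F n) d) {x : MvRat F n}
    (hx : x ∈ localSubring d hd) : twist θ c β x ∈ localSubring d hd := by
  rw [twist_apply, IsScalarTower.algebraMap_apply F (MvPolynomial (Fin n) F)]
  exact (localSubring d hd).mul_mem (algebraMap_mem_localSubring hd _)
    (apply_mem_localSubring (thetaPowS_mem_affineSubgroup hθ β) hd he h hx)

variable [NeZero n]

theorem pow_mul_twist_div_pow_mem (hθ : ∀ i, θ i ∈ affineSubgroup F n) (hd0 : d ≠ 0)
    {β : Fin n → ℤ} {e : F} (h : thetaPowS θ β (algebraMap _ (MvRat F n) d) =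
      algebraMap F (MvRat F n) e * algebraMap _ (MvRat F n) d) (k : ℕ) {D : ℕ} {b : MvRat F n}
    (hb : b ∈ polyDegSubgroup (hatField F n) (xv 0) D) :
    algebraMap _ (MvRat F n) d ^ k * twist θ c β (b / algebraMap _ (MvRat F n) d ^ k) ∈
      polyDegSubgroup (hatField F n) (xv 0) D := by
  rw [pow_mul_twist_div_pow (algebraMap_mvRat_ne_zero hd0) h]
  exact mul_mem_polyDegSubgroup (algebraMap_mem_hatField _)
    (apply_mem_polyDegSubgroup (thetaPowS_mem_affineSubgroup hθ β) hb)

theorem twist_div_pow_mem_localSubring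
    (hadd : ∀ α β, thetaPowS θ (α + β) = thetaPowS θ α * thetaPowS θ β)
    (hθ : ∀ i, θ i ∈ affineSubgroup F n) (hd : Prime d) (hdeg : 0 < d.degreeOf 0)
    {β : Fin n → ℤ}
    (hβ : β ∉ isotropyZ (thetaPowS θ) hadd thetaPowS_zero (algebraMap _ (MvRat F n) d))
    (j : ℕ) {D : ℕ} {a : MvRat F n} (ha : a ∈ polyDegSubgroup (hatField F n) (xv 0) D) :
    twist θ c β (a / algebraMap _ (MvRat F n) d ^ j) ∈ localSubring d hd := by
  have hmem := thetaPowS_mem_affineSubgroup hθ β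
  obtain ⟨p, hp⟩ := exists_algebraMap_eq_apply hmem d
  have hdp : ¬ d ∣ p := by
    intro hdvd
    refine hβ ?_
    have h0 : thetaPowS θ 0 (algebraMap _ (MvRat F n) d) = algebraMap _ (MvRat F n) d := by
      rw [thetaPowS_zero, AlgEquiv.one_apply]
    have := mem_isotropyZ_of_associated hadd h0 hp
      (hd.irreducible.associated_of_dvd (irreducible_of_apply_eq hmem hd.irreducible hp) hdvd)
    rwa [neg_zero, zero_add] at this
  rw [twist_apply, map_div₀, map_pow, hp, div_eq_mul_inv, ← inv_pow,
    IsScalarTower.algebraMap_apply F (MvPolynomial (Fin n) F)]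
  exact (localSubring d hd).mul_mem (algebraMap_mem_localSubring hd _)
    ((localSubring d hd).mul_mem
      (mem_localSubring_of_isPolyDeg hd hdeg (apply_mem_polyDegSubgroup hmem ha))
      ((localSubring d hd).pow_mem (inv_algebraMap_mem_localSubring hd hdp) j))

/-- If `a / d ^ j` is summable, then `a` is a sum of differences along generators of the isotropy
group of `d`. -/
theorem mem_sumSubgroup_of_summable
    (hcomm : ∀ i k, Commute (θ i) (θ k)) (hc : ∀ i, c i ≠ 0)
    (hθ : ∀ i, θ i ∈ affineSubgroup F n) (hd : Prime d) (hdeg : 0 < d.degreeOf 0) {j : ℕ}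
    (hj : 1 ≤ j) {a : MvRat F n}
    (ha : a ∈ polyDegSubgroup (hatField F n) (xv 0) (d.degreeOf 0)) {r : ℕ}
    (α : Fin r → Fin n → ℤ)
    (hα : AddSubgroup.closure (Set.range α) = isotropyZ (thetaPowS θ) (thetaPowS_add hcomm)
      thetaPowS_zero (algebraMap _ (MvRat F n) d)) (g : Fin n → MvRat F n)
    (hg : a / algebraMap _ (MvRat F n) d ^ j =
      ∑ i, (algebraMap F (MvRat F n) (c i) * θ i (g i) - g i)) :
    a ∈ sumSubgroup (conjTwist θ c (algebraMap _ (MvRat F n) d) j) α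
      (polyDegSubgroup (hatField F n) (xv 0) (d.degreeOf 0)) := by
  have hd0 := algebraMap_mvRat_ne_zero hd.ne_zero
  have hadd := thetaPowS_add hcomm
  set P := polyDegSubgroup (hatField F n) (xv 0) (d.degreeOf 0)
  set M := sumSubgroup (conjTwist θ c (algebraMap _ (MvRat F n) d) j) α P
  obtain ⟨π, hπP, hπO, hπb, hπT⟩ := exists_coeff (O := localSubring d hd) (P := P) (j := j)
    hd0 (algebraMap_mem_localSubring hd d) (fun b hb => mem_localSubring_of_isPolyDeg hd hdeg hb)
    (fun b hb o ho h => eq_zero_of_isPolyDeg_of_eq_mul hd hdeg hb ho h)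
    (fun o ho => exists_isPolyDeg_add_mul hd hdeg ho) (exists_pow_mul_mem_localSubring hd) hj
  have hS0 : ∀ h, conjTwist θ c (algebraMap _ (MvRat F n) d) j 0 h = h := by
    intro h
    rw [conjTwist_apply, twist_zero, mul_div_cancel₀ _ (pow_ne_zero j hd0)]
  have hSadd : ∀ β γ h, conjTwist θ c (algebraMap _ (MvRat F n) d) j (β + γ) h =
      conjTwist θ c (algebraMap _ (MvRat F n) d) j β
        (conjTwist θ c (algebraMap _ (MvRat F n) d) j γ h) := by
    intro β γ h
    rw [conjTwist_apply, conjTwist_apply, conjTwist_apply, twist_add hcomm hc,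
      mul_div_cancel_left₀ _ (pow_ne_zero j hd0)]
  have hSP : ∀ β ∈ AddSubgroup.closure (Set.range α), ∀ h ∈ P,
      conjTwist θ c (algebraMap _ (MvRat F n) d) j β h ∈ P := by
    intro β hβ h hh
    rw [hα] at hβ
    obtain ⟨e, -, hβe⟩ := hβ
    rw [conjTwist_apply]
    exact pow_mul_twist_div_pow_mem hθ hd.ne_zero hβe j hh
  have hzero : ((QuotientAddGroup.mk' M).comp π) (a / algebraMap _ (MvRat F n) d ^ j) = 0 := by
    refine map_eq_zero_of_eq_sum_sub (twist θ c) twist_zero (twist_add hcomm hc)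
      (isotropyZ (thetaPowS θ) hadd thetaPowS_zero (algebraMap _ (MvRat F n) d)) _ ?_ ?_ _ ?_
      (fun i => Pi.single i 1) g ?_
    · intro γ hγ h
      have hmem := sub_mem_sumSubgroup _ hS0 hSadd α P hSP (hα ▸ hγ) _ (hπP h)
      obtain ⟨e, he, hγe⟩ := hγ
      have := hπT (twist θ c γ) (fun x hx => twist_mem_localSubring hθ hd he hγe hx)
        (fun k b hb => pow_mul_twist_div_pow_mem hθ hd.ne_zero hγe k hb) h
      rw [← conjTwist_apply] at this
      rw [AddMonoidHom.comp_apply, AddMonoidHom.comp_apply, this]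
      exact (QuotientAddGroup.eq_iff_sub_mem).2 hmem
    · intro h
      refine (finite_setOf_not_mem_localSubring (c := c) hadd hθ hd h).subset ?_
      rintro x ⟨β, hβ, hne⟩
      refine ⟨β, hβ, fun hO => hne ?_⟩
      rw [AddMonoidHom.comp_apply, hπO _ hO, map_zero]
    · intro β hβ
      rw [AddMonoidHom.comp_apply,
        hπO _ (twist_div_pow_mem_localSubring hadd hθ hd hdeg hβ j ha), map_zero]
    · simpa only [twist_single] using hg
  rw [AddMonoidHom.comp_apply, hπb a ha] at hzero
  exact (QuotientAddGroup.eq_zero_iff a).1 hzero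

end criterion

set_option maxHeartbeats 1000000 in
/-- **Main theorem: summability criterion.** Let `f = a/d^j` be a simple
fraction (`d ∈ F[x]` irreducible, normal w.r.t. `θ_{x₁}`, `deg_{x₁} a < deg_{x₁} d`,
`j ≥ 1`). Let `θ₁,…,θ_r` (`1 ≤ r < n`), `θᵢ = θ_x^{αᵢ}`, be a basis of the isotropy group
`G_d` (with the convention `θ₁ = 1` if `G_d` is trivial), and `θᵢ(d) = εᵢ·d`, `εᵢ ∈ F*`.
Then for nonzero `c₁,…,cₙ ∈ F`, `f` is `(c₁θ_{x₁},…,cₙθ_{xₙ})`-summable in `F(x)` iff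
`a = Σᵢ (εᵢ^{−j}c^{αᵢ}θᵢ(bᵢ) − bᵢ)` for some `bᵢ ∈ F(x̂₁)[x₁]` with
`deg_{x₁} bᵢ < deg_{x₁} d`. -/
theorem stmt_10 {F : Type*} [Field F] [CharZero F] {n : ℕ} [NeZero n]
    (q : F) (hq0 : q ≠ 0) (hq : ∀ l : ℤ, l ≠ 0 → q ^ l ≠ 1)
    (θ : Fin n → (MvRat F n ≃ₐ[F] MvRat F n))
    (hθfix : ∀ i l : Fin n, i ≠ l → θ i (xv l) = xv l)
    (hθ : ∀ i : Fin n,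
      θ i (xv i) = xv i + 1 ∨ θ i (xv i) = algebraMap F (MvRat F n) q * xv i)
    (d : MvPolynomial (Fin n) F) (hd : Irreducible d) (hdeg : 0 < d.degreeOf 0)
    (hnorm : NormalWrt (hatField F n) (xv 0) (θ 0)
      (algebraMap (MvPolynomial (Fin n) F) (MvRat F n) d))
    (j : ℕ) (hj : 1 ≤ j)
    (a : MvRat F n) (ha : IsPolyDeg (hatField F n) (xv 0) (d.degreeOf 0) a)
    (r : ℕ) (hr1 : 1 ≤ r) (hrn : r < n)
    (α : Fin r → (Fin n → ℤ)) (ε : Fin r → F) (hε : ∀ i, ε i ≠ 0)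
    -- each `θᵢ = θ_x^{αᵢ}` lies in `G_d`, with `θᵢ(d) = εᵢ·d`
    (hiso : ∀ i : Fin r,
      thetaPowS θ (α i) (algebraMap (MvPolynomial (Fin n) F) (MvRat F n) d) =
        algebraMap F (MvRat F n) (ε i) * algebraMap (MvPolynomial (Fin n) F) (MvRat F n) d)
    -- the `θᵢ` generate `G_d`
    (hspan : ∀ β : Fin n → ℤ,
      (∃ c0 : F, c0 ≠ 0 ∧
        thetaPowS θ β (algebraMap (MvPolynomial (Fin n) F) (MvRat F n) d) =
          algebraMap F (MvRat F n) c0 *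
            algebraMap (MvPolynomial (Fin n) F) (MvRat F n) d) →
      ∃ t : Fin r → ℤ, β = ∑ i : Fin r, t i • α i)
    -- the `θᵢ` are independent, or `r = 1` with `θ₁ = 1` (trivial `G_d` convention)
    (hbasis : (∀ t : Fin r → ℤ, (∑ i : Fin r, t i • α i) = 0 → t = 0) ∨
      (r = 1 ∧ α = 0))
    (c : Fin n → F) (hc : ∀ i, c i ≠ 0) :
    (∃ g : Fin n → MvRat F n,
        a / algebraMap (MvPolynomial (Fin n) F) (MvRat F n) d ^ j =
          ∑ i : Fin n, (algebraMap F (MvRat F n) (c i) * θ i (g i) - g i)) ↔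
    (∃ b : Fin r → MvRat F n,
        (∀ i, IsPolyDeg (hatField F n) (xv 0) (d.degreeOf 0) (b i)) ∧
        a = ∑ i : Fin r,
          (algebraMap F (MvRat F n) (ε i ^ (-(j : ℤ)) * ∏ l : Fin n, c l ^ (α i l)) *
              thetaPowS θ (α i) (b i) - b i)) := by
  have hθaff : ∀ i, θ i ∈ affineSubgroup F n := by
    intro i l
    rcases eq_or_ne i l with rfl | hil
    · rcases hθ i with h | h
      · exact ⟨1, 1, one_ne_zero, by rw [h, map_one, one_mul]⟩
      · exact ⟨q, 0, hq0, by rw [h, map_zero, add_zero]⟩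
    · exact ⟨1, 0, one_ne_zero, by rw [hθfix i l hil, map_one, one_mul, map_zero, add_zero]⟩
  have hcomm := commute_of_fix hθfix hθaff
  have hd0 := algebraMap_mvRat_ne_zero hd.ne_zero
  constructor
  · rintro ⟨g, hg⟩
    have hα : AddSubgroup.closure (Set.range α) = isotropyZ (thetaPowS θ) (thetaPowS_add hcomm)
        thetaPowS_zero (algebraMap _ (MvRat F n) d) := by
      refine le_antisymm ((AddSubgroup.closure_le _).2 ?_) fun β hβ => ?_
      · rintro _ ⟨i, rfl⟩
        exact ⟨ε i, hε i, hiso i⟩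
      · obtain ⟨t, ht⟩ := hspan β hβ
        exact mem_closure_range_of_eq_sum_smul t ht
    obtain ⟨b, hb, hab⟩ := mem_sumSubgroup_of_summable hcomm hc hθaff hd.prime hdeg hj ha α hα g hg
    refine ⟨b, hb, hab.trans (Finset.sum_congr rfl fun i _ => ?_)⟩
    rw [conjTwist_apply, pow_mul_twist_div_pow hd0 (hiso i)]
  · rintro ⟨b, -, hab⟩
    obtain ⟨g, hg⟩ := exists_eq_sum_of_twist_sub hcomm hc α
      fun i => b i / algebraMap (MvPolynomial (Fin n) F) (MvRat F n) d ^ j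
    refine ⟨g, ?_⟩
    rw [← hg, hab, Finset.sum_div]
    refine Finset.sum_congr rfl fun i _ => ?_
    rw [sub_div, ← pow_mul_twist_div_pow hd0 (hiso i),
      mul_div_cancel_left₀ _ (pow_ne_zero j hd0)]
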